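/- Let U, X, Y be finite sets, n ≥ 1 an integer, and Q_{UX} a joint distribution on U × X such that n·Q_{UX}(u,x) ∈ ℤ for all (u,x) (a joint type). Let P_U be the uniform distribution on the type class T^n(Q_U) ⊆ U^n (sequences with empirical distribution Q_U), and for u ∈ T^n(Q_U) let P_{X|U}(·|u) be the uniform distribution on the conditional type class T^n_u(Q_{X|U}) ⊆ X^n (sequences x such that (u,x) has joint empirical distribution Q_{UX}). Let W(·|x) be a channel from X to Y, q : X × Y → (0,∞) a strictly positive metric, and write W^n(y|x) = ∏_i W(y_i|x_i), q^n(x,y) = ∏_i q(x_i,y_i), and a^n(u,x) = Σ_i a(u_i,x_i) for a function a : U × X → ℝ. Define p(ū,x,y) := Σ_{x̄} P_{X|U}(x̄|ū) 1{ q^n(x̄,y) ≥ q^n(x,y) } and the type-0 error probability P̄_{e,0} := Σ_{u,x,y} P_U(u) P_{X|U}(x|u) W^n(y|x) ( 1 − ( Σ_{ū} P_U(ū) (1 − p(ū,x,y))^{M₁} )^{M₀−1} ). Then for all ρ₀ ∈ [0,1], ρ₁ ∈ [0,1], s ≥ 0, and a : U × X → ℝ, P̄_{e,0} ≤ Σ_{u,x,y}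 P_U(u) P_{X|U}(x|u) W^n(y|x) ( M₀ Σ_{ū} P_U(ū) ( M₁ Σ_{x̄} P_{X|U}(x̄|ū) q^n(x̄,y)^s e^{a^n(ū,x̄)} / ( q^n(x,y)^s e^{a^n(u,x)} ) )^{ρ₁} )^{ρ₀}. -/

import Mathlib

open scoped BigOperators

attribute [local instance] Classical.propDecidable

section

variable {U X Y : Type*} [Fintype U] [Fintype X] [Fintype Y]
  [DecidableEq U] [DecidableEq X]

/-- The type class `T^n(Q_U)`: sequences in `U^n` with empirical distribution `Q_U`. -/
noncomputable def typeClassU (n : ℕ) (QU : U → ℝ) : Finset (Fin n → U) :=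
  Finset.univ.filter fun u =>
    ∀ a : U, ((Finset.univ.filter fun i => u i = a).card : ℝ) = n * QU a

/-- Uniform distribution `P_U` on the type class `T^n(Q_U)`. -/
noncomputable def PUcc (n : ℕ) (QU : U → ℝ) (u : Fin n → U) : ℝ :=
  if u ∈ typeClassU n QU then (1 : ℝ) / (typeClassU n QU).card else 0

/-- The conditional type class `T^n_u(Q_{X|U})`: sequences `x ∈ X^n` such that `(u,x)`
has joint empirical distribution `Q_{UX}`. -/
noncomputable def typeClassXU (n : ℕ) (Q : U → X → ℝ) (u : Fin n → U) :
    Finset (Fin n → X) :=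
  Finset.univ.filter fun x =>
    ∀ a : U, ∀ b : X,
      ((Finset.univ.filter fun i => u i = a ∧ x i = b).card : ℝ) = n * Q a b

/-- Uniform distribution `P_{X|U}(·|u)` on the conditional type class `T^n_u(Q_{X|U})`. -/
noncomputable def PXUcc (n : ℕ) (Q : U → X → ℝ) (u : Fin n → U) (x : Fin n → X) : ℝ :=
  if x ∈ typeClassXU n Q u then (1 : ℝ) / (typeClassXU n Q u).card else 0

/-- The `n`-letter memoryless channel `W^n(y|x)`. -/
noncomputable def Wn (n : ℕ) (W : X → Y → ℝ) (x : Fin n → X) (y : Fin n → Y) : ℝ :=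
  ∏ i, W (x i) (y i)

/-- The `n`-letter product metric `q^n(x,y)`. -/
noncomputable def qn (n : ℕ) (q : X → Y → ℝ) (x : Fin n → X) (y : Fin n → Y) : ℝ :=
  ∏ i, q (x i) (y i)

/-- The additive `n`-letter extension `a^n(u,x) = Σᵢ a(uᵢ,xᵢ)`. -/
noncomputable def an (n : ℕ) (a : U → X → ℝ) (u : Fin n → U) (x : Fin n → X) : ℝ :=
  ∑ i, a (u i) (x i)

/-- `p(ū,x,y) = Σ_{x̄} P_{X|U}(x̄|ū) 1{q^n(x̄,y) ≥ q^n(x,y)}`. -/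
noncomputable def pcc (n : ℕ) (Q : U → X → ℝ) (q : X → Y → ℝ)
    (ub : Fin n → U) (x : Fin n → X) (y : Fin n → Y) : ℝ :=
  ∑ xb, PXUcc n Q ub xb * (if qn n q x y ≤ qn n q xb y then 1 else 0)

/-- The type-0 error probability `P̄_{e,0}` of the constant-composition
superposition-coding ensemble. -/
noncomputable def Pe0 (n : ℕ) (Q : U → X → ℝ) (W : X → Y → ℝ) (q : X → Y → ℝ)
    (M₀ M₁ : ℕ) : ℝ :=
  ∑ u, ∑ x, ∑ y, PUcc n (fun a => ∑ b, Q a b) u * PXUcc n Q u x * Wn n W x y *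
    (1 - (∑ ub, PUcc n (fun a => ∑ b, Q a b) ub *
      (1 - pcc n Q q ub x y) ^ M₁) ^ (M₀ - 1))

/-- On pairs of joint type `Q`, the additive extension `an` depends only on `Q`. -/
lemma an_eq_of_mem_typeClassXU {n : ℕ} {Q : U → X → ℝ} {u : Fin n → U} {x : Fin n → X}
    (hx : x ∈ typeClassXU n Q u) (a : U → X → ℝ) :
    an n a u x = ∑ b, ∑ c, (n * Q b c) * a b c := by
  simp only [typeClassXU, Finset.mem_filter, Finset.mem_univ, true_and] at hx
  simp only [an, ← hx, Finset.card_filter, Nat.cast_sum, Finset.sum_mul]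
  rw [← Fintype.sum_prod_type', Finset.sum_comm]
  refine Finset.sum_congr rfl fun i _ => ?_
  rw [Finset.sum_eq_single (u i, x i)]
  · simp
  · rintro ⟨b, c⟩ - hbc
    have : ¬ (u i = b ∧ x i = c) := fun h => hbc (by rw [h.1, h.2])
    simp [this]
  · simp

lemma PUcc_nonneg (n : ℕ) (QU : U → ℝ) (u : Fin n → U) : 0 ≤ PUcc n QU u := by
  unfold PUcc
  split_ifs <;> positivity

lemma sum_PUcc {n : ℕ} {QU : U → ℝ} {u : Fin n → U} (hu : u ∈ typeClassU n QU) :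
    ∑ v, PUcc n QU v = 1 := by
  have h : ((typeClassU n QU).card : ℝ) ≠ 0 := by
    exact_mod_cast Finset.card_ne_zero_of_mem hu
  simp only [PUcc, ← Finset.sum_filter, Finset.filter_mem_eq_inter, Finset.univ_inter,
    Finset.sum_const, nsmul_eq_mul]
  field_simp

lemma PXUcc_nonneg (n : ℕ) (Q : U → X → ℝ) (u : Fin n → U) (x : Fin n → X) :
    0 ≤ PXUcc n Q u x := by
  unfold PXUcc
  split_ifs <;> positivity

lemma sum_PXUcc_le_one (n : ℕ) (Q : U → X → ℝ) (u : Fin n → U) :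
    ∑ x, PXUcc n Q u x ≤ 1 := by
  simp only [PXUcc, ← Finset.sum_filter, Finset.filter_mem_eq_inter, Finset.univ_inter,
    Finset.sum_const, nsmul_eq_mul]
  rw [mul_one_div]
  exact div_self_le_one _

omit [Fintype X] [Fintype Y] [DecidableEq X] in
lemma qn_pos (n : ℕ) {q : X → Y → ℝ} (hq : ∀ x y, 0 < q x y)
    (x : Fin n → X) (y : Fin n → Y) : 0 < qn n q x y :=
  Finset.prod_pos fun _ _ => hq _ _

omit [Fintype Y] in
lemma pcc_nonneg (n : ℕ) (Q : U → X → ℝ) (q : X → Y → ℝ)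
    (ub : Fin n → U) (x : Fin n → X) (y : Fin n → Y) : 0 ≤ pcc n Q q ub x y :=
  Finset.sum_nonneg fun _ _ => mul_nonneg (PXUcc_nonneg ..) (by split_ifs <;> norm_num)

omit [Fintype Y] in
lemma pcc_le_one (n : ℕ) (Q : U → X → ℝ) (q : X → Y → ℝ)
    (ub : Fin n → U) (x : Fin n → X) (y : Fin n → Y) : pcc n Q q ub x y ≤ 1 :=
  (Finset.sum_le_sum fun _ _ => mul_le_of_le_one_right (PXUcc_nonneg ..)
    (by split_ifs <;> norm_num)).trans (sum_PXUcc_le_one n Q ub)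

omit [Fintype Y] in
/-- Markov's inequality for `pcc`, tilted by the additive function `an`. -/
lemma pcc_le {n : ℕ} {Q : U → X → ℝ} {q : X → Y → ℝ} (hq : ∀ x y, 0 < q x y)
    {s : ℝ} (hs : 0 ≤ s) (a : U → X → ℝ) {u : Fin n → U} {x : Fin n → X}
    (hx : x ∈ typeClassXU n Q u) (ub : Fin n → U) (y : Fin n → Y) :
    pcc n Q q ub x y ≤
      (∑ xb, PXUcc n Q ub xb * qn n q xb y ^ s * Real.exp (an n a ub xb)) /
        (qn n q x y ^ s * Real.exp (an n a u x)) := by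
  have hpos := Real.rpow_pos_of_pos (qn_pos n hq x y) s
  rw [le_div_iff₀ (by positivity), pcc, Finset.sum_mul]
  refine Finset.sum_le_sum fun xb _ => ?_
  by_cases hxb : xb ∈ typeClassXU n Q ub
  · rw [an_eq_of_mem_typeClassXU hx, an_eq_of_mem_typeClassXU hxb, mul_assoc, mul_assoc]
    refine mul_le_mul_of_nonneg_left ?_ (PXUcc_nonneg ..)
    split_ifs with h
    · rw [one_mul]
      gcongr
      exact (qn_pos n hq x y).le
    · rw [zero_mul]
      exact mul_nonneg (Real.rpow_nonneg (qn_pos n hq xb y).le s) (Real.exp_nonneg _)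
  · simp [PXUcc, hxb]

/-- The union bound `1 - (1 - t) ^ m ≤ min {1, M t}` combined with `min {1, α} ≤ α ^ ρ`. -/
lemma one_sub_pow_le_rpow {t B ρ : ℝ} {m M : ℕ} (ht0 : 0 ≤ t) (ht1 : t ≤ 1) (hB : t ≤ B)
    (hm : m ≤ M) (hρ : ρ ∈ Set.Icc (0 : ℝ) 1) :
    1 - (1 - t) ^ m ≤ ((M : ℝ) * B) ^ ρ := by
  have hα : 0 ≤ (M : ℝ) * t := by positivity
  have hmM : (m : ℝ) * t ≤ M * t := by gcongr
  have hmono : ((M : ℝ) * t) ^ ρ ≤ (M * B) ^ ρ :=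
    Real.rpow_le_rpow hα (by gcongr) hρ.1
  refine le_trans ?_ hmono
  rcases le_total ((M : ℝ) * t) 1 with h | h
  · have hbern := one_add_mul_le_pow (a := -t) (by linarith) m
    have hle := Real.rpow_le_rpow_of_exponent_ge' hα h hρ.1 hρ.2
    rw [Real.rpow_one] at hle
    rw [← sub_eq_add_neg] at hbern
    linarith
  · have hone := Real.one_le_rpow h hρ.1
    have hpow : 0 ≤ (1 - t) ^ m := pow_nonneg (by linarith) m
    linarith

/-- Gallager-style bound (equation (56) of the paper) on the type-0 error probability
of the constant-composition superposition-coding ensemble. -/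
theorem sc_gallager_bound
    (n : ℕ) (hn : 1 ≤ n)
    (Q : U → X → ℝ) (hQ0 : ∀ u x, 0 ≤ Q u x) (hQ1 : ∑ u, ∑ x, Q u x = 1)
    (hQint : ∀ u x, ∃ m : ℕ, (n : ℝ) * Q u x = m)
    (W : X → Y → ℝ) (hW0 : ∀ x y, 0 ≤ W x y) (hW1 : ∀ x, ∑ y, W x y = 1)
    (q : X → Y → ℝ) (hq : ∀ x y, 0 < q x y)
    (M₀ M₁ : ℕ) (hM₀ : 1 ≤ M₀) (hM₁ : 1 ≤ M₁)
    (ρ₀ ρ₁ s : ℝ) (hρ₀ : ρ₀ ∈ Set.Icc (0 : ℝ) 1) (hρ₁ : ρ₁ ∈ Set.Icc (0 : ℝ) 1)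
    (hs : 0 ≤ s) (a : U → X → ℝ) :
    Pe0 n Q W q M₀ M₁ ≤
      ∑ u, ∑ x, ∑ y, PUcc n (fun a' => ∑ b, Q a' b) u * PXUcc n Q u x * Wn n W x y *
        ((M₀ : ℝ) * ∑ ub, PUcc n (fun a' => ∑ b, Q a' b) ub *
          ((M₁ : ℝ) * (∑ xb, PXUcc n Q ub xb * qn n q xb y ^ s * Real.exp (an n a ub xb)) /
            (qn n q x y ^ s * Real.exp (an n a u x))) ^ ρ₁) ^ ρ₀ := by
  refine Finset.sum_le_sum fun u _ => Finset.sum_le_sum fun x _ =>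
    Finset.sum_le_sum fun y _ => ?_
  by_cases hu : u ∈ typeClassU n fun a' => ∑ b, Q a' b
  swap
  · simp [PUcc, hu]
  by_cases hx : x ∈ typeClassXU n Q u
  swap
  · simp [PXUcc, hx]
  refine mul_le_mul_of_nonneg_left ?_ (mul_nonneg (mul_nonneg (PUcc_nonneg ..)
    (PXUcc_nonneg ..)) (Finset.prod_nonneg fun _ _ => hW0 _ _))
  set P := PUcc n fun a' => ∑ b, Q a' b
  have hP0 : ∀ ub, 0 ≤ P ub := PUcc_nonneg n _
  have hP1 : ∑ ub, P ub = 1 := sum_PUcc hu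
  have hp0 : ∀ ub, 0 ≤ 1 - pcc n Q q ub x y := fun ub =>
    sub_nonneg.2 (pcc_le_one n Q q ub x y)
  have hS0 : 0 ≤ ∑ ub, P ub * (1 - pcc n Q q ub x y) ^ M₁ :=
    Finset.sum_nonneg fun ub _ => mul_nonneg (hP0 ub) (pow_nonneg (hp0 ub) _)
  have hS1 : ∑ ub, P ub * (1 - pcc n Q q ub x y) ^ M₁ ≤ 1 :=
    (Finset.sum_le_sum fun ub _ => mul_le_of_le_one_right (hP0 ub)
      (pow_le_one₀ (hp0 ub) (sub_le_self _ (pcc_nonneg n Q q ub x y)))).trans_eq hP1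
  have key := one_sub_pow_le_rpow
    (t := 1 - ∑ ub, P ub * (1 - pcc n Q q ub x y) ^ M₁)
    (B := ∑ ub, P ub *
      ((M₁ : ℝ) * (∑ xb, PXUcc n Q ub xb * qn n q xb y ^ s * Real.exp (an n a ub xb)) /
        (qn n q x y ^ s * Real.exp (an n a u x))) ^ ρ₁)
    (by linarith) (by linarith) ?_ (Nat.sub_le M₀ 1) hρ₀
  · rwa [sub_sub_cancel] at key
  · rw [sub_le_iff_le_add, ← Finset.sum_add_distrib]
    refine hP1.ge.trans (Finset.sum_le_sum fun ub _ => ?_)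
    rw [← mul_add, mul_div_assoc]
    exact le_mul_of_one_le_right (hP0 ub) (sub_le_iff_le_add.1 (one_sub_pow_le_rpow
      (pcc_nonneg ..) (pcc_le_one ..) (pcc_le hq hs a hx ub y) le_rfl hρ₁))

end
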